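/- arXiv:1006.3776 — 2 statements merged into one kernel-verified Lean document; each statement's English description precedes it below -/
import Mathlib

section
/- Let G be a finite simple graph with maximum degree Δ(G) ≥ 4. If mad(G) < 14/5, then the injective chromatic number of G satisfies χ_i(G) ≤ Δ(G) + 2. -/
open SimpleGraph

/-- An injective coloring of `G`: any two distinct vertices with a common neighbor
receive distinct colors. -/
def IsInjColoring {V α : Type*} (G : SimpleGraph V) (c : V → α) : Prop :=
  ∀ ⦃u v : V⦄, u ≠ v → (∃ w, G.Adj u w ∧ G.Adj v w) → c u ≠ c v

/-- The injective chromatic number of `G`: the least `k` such that `G` has an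
injective coloring with `k` colors. -/
noncomputable def injChromNum {V : Type*} (G : SimpleGraph V) : ℕ :=
  sInf {k | ∃ c : V → Fin k, IsInjColoring G c}

section

open Finset

variable {V : Type*} {k : ℕ}

/-- `c` satisfies every injective coloring constraint between vertices outside `U`. -/
def IsInjColoringOff (G : SimpleGraph V) (c : V → Fin k) (U : Set V) : Prop :=
  ∀ ⦃a b : V⦄, a ∉ U → b ∉ U → a ≠ b → (∃ w, G.Adj a w ∧ G.Adj b w) → c a ≠ c b

theorem isInjColoringOff_empty {G : SimpleGraph V} {c : V → Fin k} :
    IsInjColoringOff G c ∅ ↔ IsInjColoring G c := by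
  simp [IsInjColoringOff, IsInjColoring]

theorem IsInjColoring.off_of_deleteEdges {G : SimpleGraph V} {c : V → Fin k} {u v : V}
    (h : IsInjColoring (G.deleteEdges {s(u, v)}) c) : IsInjColoringOff G c {u, v} := by
  rintro a b ha hb hab ⟨w, haw, hbw⟩
  simp only [Set.mem_insert_iff, Set.mem_singleton_iff, not_or] at ha hb
  refine h hab ⟨w, ?_, ?_⟩ <;> simp [SimpleGraph.deleteEdges_adj, *]

section Discharging

variable [Fintype V] (G : SimpleGraph V) [DecidableRel G.Adj]

/-- The charge that `u` sends to its neighbor `v`. -/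
def gift (u v : V) : ℤ :=
  if G.degree v = 2 then 2 else if G.degree v = 3 ∧ 4 ≤ G.degree u then 1 else 0

/-- The initial charge, normalized to be five times the degree excess over `14 / 5`. -/
def initialCharge (v : V) : ℤ :=
  if G.degree v = 0 then 0 else 5 * G.degree v - 14

/-- The charge after discharging. -/
def finalCharge (v : V) : ℤ :=
  initialCharge G v + ∑ u ∈ G.neighborFinset v, (gift G u v - gift G v u)

theorem sum_finalCharge :
    ∑ v, finalCharge G v = ∑ v, initialCharge G v := by
  simp only [finalCharge, sum_add_distrib, sum_sub_distrib, SimpleGraph.neighborFinset_eq_filter,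
    sum_filter]
  rw [sum_comm (f := fun v u => if G.Adj v u then gift G u v else 0)]
  simp [SimpleGraph.adj_comm]

theorem le_finalCharge_of_four_le {v : V} (hv : 4 ≤ G.degree v) :
    4 * (G.degree v : ℤ) - 14 - #{u ∈ G.neighborFinset v | G.degree u = 2} ≤
      finalCharge G v := by
  have h : ∑ u ∈ G.neighborFinset v, (-1 - if G.degree u = 2 then (1 : ℤ) else 0) ≤
      ∑ u ∈ G.neighborFinset v, (gift G u v - gift G v u) := by
    refine sum_le_sum fun u _ => ?_
    unfold gift
    split_ifs <;> omega
  rw [sum_sub_distrib, sum_boole, sum_const, SimpleGraph.card_neighborFinset_eq_degree] at h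
  simp only [nsmul_eq_mul, mul_neg, mul_one] at h
  unfold finalCharge initialCharge
  rw [if_neg (by omega)]
  linarith

end Discharging

variable [DecidableEq V]

theorem IsInjColoringOff.update {G : SimpleGraph V} {c : V → Fin k} {a : V} {U : Set V}
    (h : IsInjColoringOff G c (insert a U)) {α : Fin k}
    (hα : ∀ w, G.Adj a w → ∀ x, G.Adj x w → x ≠ a → c x ≠ α) :
    IsInjColoringOff G (Function.update c a α) U := by
  rintro x y hx hy hxy ⟨w, hxw, hyw⟩
  by_cases hxa : x = a
  · subst hxa
    rw [Function.update_self, Function.update_of_ne hxy.symm]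
    exact (hα w hxw y hyw hxy.symm).symm
  · by_cases hya : y = a
    · subst hya
      rw [Function.update_self, Function.update_of_ne hxy]
      exact hα w hyw x hxw hxy
    · rw [Function.update_of_ne hxa, Function.update_of_ne hya]
      exact h (by simp [hxa, hx]) (by simp [hya, hy]) hxy ⟨w, hxw, hyw⟩

variable [Fintype V]

/-- An upper bound for the number of vertices that have a common neighbor with `a`. -/
def conflictBound (G : SimpleGraph V) [DecidableRel G.Adj] (a : V) : ℕ :=
  ∑ w ∈ G.neighborFinset a, (G.degree w - 1)

theorem IsInjColoringOff.exists_recolor {G : SimpleGraph V} [DecidableRel G.Adj]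
    {c : V → Fin k} {a : V} {U : Set V} (h : IsInjColoringOff G c (insert a U))
    (ha : conflictBound G a < k) : ∃ c' : V → Fin k, IsInjColoringOff G c' U := by
  set F := ((G.neighborFinset a).biUnion fun w => (G.neighborFinset w).erase a).image c with hF
  have hcard : F.card < (univ : Finset (Fin k)).card := by
    rw [card_univ, Fintype.card_fin]
    refine lt_of_le_of_lt (card_image_le.trans (card_biUnion_le.trans (sum_le_sum ?_))) ha
    intro w hw
    rw [card_erase_of_mem (by simpa [SimpleGraph.adj_comm] using hw),
      SimpleGraph.card_neighborFinset_eq_degree]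
  obtain ⟨α, -, hα⟩ := exists_mem_notMem_of_card_lt_card hcard
  refine ⟨_, h.update (α := α) fun w haw x hxw hxa hx => hα ?_⟩
  rw [hF, mem_image]
  exact ⟨x, mem_biUnion.2 ⟨w, by simpa using haw, by simp [hxa, hxw.symm]⟩, hx⟩

/-- `G` has maximum degree at most `D`, no injective coloring with `D + 2` colors, and is
edge-minimal with respect to the latter. -/
structure IsInjCritical (G : SimpleGraph V) [DecidableRel G.Adj] (D : ℕ) : Prop where
  four_le : 4 ≤ D
  degree_le : ∀ v, G.degree v ≤ D
  not_colorable : ¬ ∃ c : V → Fin (D + 2), IsInjColoring G c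
  deleteEdge_colorable : ∀ u v, G.Adj u v →
    ∃ c : V → Fin (D + 2), IsInjColoring (G.deleteEdges {s(u, v)}) c

/-- A vertex of degree two with a neighbor of degree four. -/
def IsTwoFour (G : SimpleGraph V) [DecidableRel G.Adj] (e : V) : Prop :=
  G.degree e = 2 ∧ ∃ w, G.Adj e w ∧ G.degree w = 4

/-- Two distinct vertices of degree two, both with a neighbor of degree four, that have a
common neighbor. -/
def TwoFourLinked (G : SimpleGraph V) [DecidableRel G.Adj] (e f : V) : Prop :=
  IsTwoFour G e ∧ IsTwoFour G f ∧ e ≠ f ∧ ∃ w, G.Adj e w ∧ G.Adj f w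

/-- At most one neighbor of `w` is either `e` or has its color in `B`. -/
def AlmostAvoids (G : SimpleGraph V) [DecidableRel G.Adj] (c : V → Fin k) (e : V)
    (B : Finset (Fin k)) (w : V) : Prop :=
  #{x ∈ G.neighborFinset w | x = e ∨ c x ∈ B} ≤ 1

variable {G : SimpleGraph V} [DecidableRel G.Adj] {D : ℕ}

theorem neighborFinset_eq_pair_of_degree_eq_two {e w : V} (he : G.degree e = 2)
    (hw : G.Adj e w) : ∃ w', w ≠ w' ∧ G.neighborFinset e = {w, w'} := by
  rw [← SimpleGraph.card_neighborFinset_eq_degree, card_eq_two] at he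
  obtain ⟨x, y, hxy, h⟩ := he
  have : w ∈ G.neighborFinset e := by simpa using hw
  rw [h, mem_insert, mem_singleton] at this
  rcases this with rfl | rfl
  · exact ⟨y, hxy, h⟩
  · exact ⟨x, hxy.symm, by rw [h, pair_comm]⟩

namespace IsInjCritical

theorem conflictBound_lt (h : IsInjCritical G D) {u v : V} (huv : G.Adj u v)
    (hu : conflictBound G u ≤ D + 1) : D + 1 < conflictBound G v := by
  by_contra! hv
  obtain ⟨c, hc⟩ := h.deleteEdge_colorable u v huv
  obtain ⟨c₁, hc₁⟩ := hc.off_of_deleteEdges.exists_recolor (by omega)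
  rw [← insert_empty_eq] at hc₁
  obtain ⟨c₂, hc₂⟩ := hc₁.exists_recolor (by omega)
  exact h.not_colorable ⟨c₂, isInjColoringOff_empty.1 hc₂⟩

theorem exists_off (h : IsInjCritical G D) {u v : V} (huv : G.Adj u v)
    (hu : conflictBound G u ≤ D + 1) : ∃ c : V → Fin (D + 2), IsInjColoringOff G c {v} := by
  obtain ⟨c, hc⟩ := h.deleteEdge_colorable u v huv
  exact hc.off_of_deleteEdges.exists_recolor (by omega)

theorem degree_ne_one (h : IsInjCritical G D) (v : V) : G.degree v ≠ 1 := by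
  intro hv
  obtain ⟨u, hu⟩ := card_eq_one.1 ((G.card_neighborFinset_eq_degree v).trans hv)
  have hadj : ∀ x, G.Adj v x ↔ x = u := fun x => by
    rw [← SimpleGraph.mem_neighborFinset, hu, mem_singleton]
  obtain ⟨c, hc⟩ := h.deleteEdge_colorable v u ((hadj u).2 rfl)
  have hc' : IsInjColoringOff G c (insert v ∅) := by
    rintro a b ha hb hab ⟨w, haw, hbw⟩
    simp only [insert_empty_eq, Set.mem_singleton_iff] at ha hb
    have hwv : w ≠ v := by
      rintro rfl
      exact hab (((hadj a).1 haw.symm).trans ((hadj b).1 hbw.symm).symm)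
    refine hc hab ⟨w, ?_, ?_⟩ <;> simp [SimpleGraph.deleteEdges_adj, *]
  obtain ⟨c₂, hc₂⟩ := hc'.exists_recolor (by
    have := h.degree_le u
    simp only [conflictBound, hu, sum_singleton]
    omega)
  exact h.not_colorable ⟨c₂, isInjColoringOff_empty.1 hc₂⟩

theorem conflictBound_le_of_degree_eq_two (h : IsInjCritical G D) {e w : V}
    (he : G.degree e = 2) (hw : G.Adj e w) :
    conflictBound G e ≤ G.degree w - 1 + (D - 1) := by
  obtain ⟨w', hne, hN⟩ := neighborFinset_eq_pair_of_degree_eq_two he hw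
  rw [conflictBound, hN, sum_pair hne]
  have := h.degree_le w'
  omega

theorem three_le_degree_of_adj (h : IsInjCritical G D) {e w : V}
    (he : G.degree e = 2) (hw : G.Adj e w) : 3 ≤ G.degree w := by
  by_contra! hlt
  have h0 : 0 < G.degree w := (G.degree_pos_iff_exists_adj w).2 ⟨e, hw.symm⟩
  have h1 := h.degree_ne_one w
  have h2 : G.degree w = 2 := by omega
  have h4 := h.four_le
  have := h.conflictBound_le_of_degree_eq_two he hw
  have := h.conflictBound_le_of_degree_eq_two h2 hw.symm
  have := h.conflictBound_lt hw (by omega)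
  omega

/-- If only `e` violates the constraints, the colors around its two neighbors partition the
palette, as otherwise `e` could be recolored. -/
theorem degree_and_image_compl (h : IsInjCritical G D) {e : V} (he : IsTwoFour G e)
    {c : V → Fin (D + 2)} (hc : IsInjColoringOff G c {e}) {w w' : V} (hww : w ≠ w')
    (hw : G.Adj e w) (hw' : G.Adj e w') :
    4 ≤ G.degree w ∧ ((G.neighborFinset w').erase e).image c =
      (((G.neighborFinset w).erase e).image c)ᶜ := by
  have hD := h.four_le
  obtain ⟨he2, u, hu, hu4⟩ := he
  obtain ⟨w'', hne, hN⟩ := neighborFinset_eq_pair_of_degree_eq_two he2 hw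
  have hw'' : w' = w'' := by
    have : w' ∈ G.neighborFinset e := by simpa using hw'
    rw [hN, mem_insert, mem_singleton] at this
    exact this.resolve_left hww.symm
  subst hw''
  have hsum : G.degree w + G.degree w' ≤ D + 4 := by
    have : u ∈ G.neighborFinset e := by simpa using hu
    have h1 := h.degree_le w
    have h2 := h.degree_le w'
    rw [hN, mem_insert, mem_singleton] at this
    rcases this with rfl | rfl <;> omega
  set A := ((G.neighborFinset w).erase e).image c with hA
  set A' := ((G.neighborFinset w').erase e).image c with hA'
  have hcover : A ∪ A' = univ := by
    by_contra hne
    obtain ⟨α, hα⟩ := not_forall.1 (mt eq_univ_iff_forall.2 hne)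
    rw [mem_union, not_or] at hα
    rw [← insert_empty_eq] at hc
    refine h.not_colorable ⟨_, isInjColoringOff_empty.1 (hc.update (α := α) ?_)⟩
    intro z hz x hx hxe hxα
    have : z ∈ G.neighborFinset e := by simpa using hz
    rw [hN, mem_insert, mem_singleton] at this
    rcases this with rfl | rfl
    · exact hα.1 (mem_image.2 ⟨x, by simp [hxe, hx.symm], hxα⟩)
    · exact hα.2 (mem_image.2 ⟨x, by simp [hxe, hx.symm], hxα⟩)
  have hcA : #A ≤ G.degree w - 1 := by
    refine card_image_le.trans (le_of_eq ?_)
    rw [card_erase_of_mem (by simpa using hw.symm), SimpleGraph.card_neighborFinset_eq_degree]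
  have hcA' : #A' ≤ G.degree w' - 1 := by
    refine card_image_le.trans (le_of_eq ?_)
    rw [card_erase_of_mem (by simpa using hw'.symm), SimpleGraph.card_neighborFinset_eq_degree]
  have hun : #(A ∪ A') = D + 2 := by rw [hcover, card_univ, Fintype.card_fin]
  have hui := card_union_add_card_inter A A'
  have h2 := h.degree_le w'
  have h0 := (G.degree_pos_iff_exists_adj w).2 ⟨e, hw.symm⟩
  have h0' := (G.degree_pos_iff_exists_adj w').2 ⟨e, hw'.symm⟩
  refine ⟨by omega, ?_⟩
  have hdisj : Disjoint A A' := by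
    rw [disjoint_iff_inter_eq_empty, ← card_eq_zero]
    omega
  exact (IsCompl.compl_eq ⟨hdisj, codisjoint_iff.2 hcover⟩).symm

theorem off_update_of_linked (h : IsInjCritical G D) {e f w : V} (he : IsTwoFour G e)
    {c : V → Fin (D + 2)} (hc : IsInjColoringOff G c {e}) (hef : e ≠ f)
    (hew : G.Adj e w) (hfw : G.Adj f w) :
    IsInjColoringOff G (Function.update c e (c f)) {f} := by
  have hc' : IsInjColoringOff G c (insert e {f}) :=
    fun a b ha hb => hc (fun h => ha (Or.inl h)) (fun h => hb (Or.inl h))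
  have hfA : c f ∈ ((G.neighborFinset w).erase e).image c :=
    mem_image_of_mem _ (by simp [hef.symm, hfw.symm])
  rintro a b ha hb hab ⟨z, haz, hbz⟩
  have key : ∀ b, b ≠ e → b ≠ f → ∀ z, G.Adj e z → G.Adj b z → c b ≠ c f := by
    intro b hbe hbf z hez hbz hcb
    by_cases hzw : w = z
    · subst hzw
      exact hc hbe hef.symm hbf ⟨w, hbz, hfw⟩ hcb
    · have := (h.degree_and_image_compl he hc hzw hew hez).2
      have hb : c b ∈ ((G.neighborFinset z).erase e).image c :=
        mem_image_of_mem _ (by simp [hbe, hbz.symm])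
      rw [this, mem_compl, hcb] at hb
      exact hb hfA
  by_cases hae : a = e
  · subst hae
    rw [Function.update_self, Function.update_of_ne hab.symm]
    exact (key b hab.symm hb z haz hbz).symm
  · by_cases hbe : b = e
    · subst hbe
      rw [Function.update_self, Function.update_of_ne hab]
      exact key a hab ha z hbz haz
    · rw [Function.update_of_ne hae, Function.update_of_ne hbe]
      exact hc hae hbe hab ⟨z, haz, hbz⟩

theorem almostAvoids_of_update (h : IsInjCritical G D) {e f w : V} (he : IsTwoFour G e)
    {c : V → Fin (D + 2)} (hc : IsInjColoringOff G c {e}) (hef : e ≠ f)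
    (hew : G.Adj e w) (hfw : G.Adj f w) {B : Finset (Fin (D + 2))}
    (hB : ((G.neighborFinset w).erase e).image c = B ∨
      ((G.neighborFinset w).erase e).image c = Bᶜ) {z : V}
    (hz : AlmostAvoids G (Function.update c e (c f)) f B z) : AlmostAvoids G c e B z := by
  have hfA : c f ∈ ((G.neighborFinset w).erase e).image c :=
    mem_image_of_mem _ (by simp [hef.symm, hfw.symm])
  unfold AlmostAvoids at hz ⊢
  by_cases hfB : c f ∈ B
  · refine le_of_eq_of_le (congrArg card (filter_congr fun x _ => ?_)) hz
    by_cases hxe : x = e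
    · simp [hxe, hfB]
    · by_cases hxf : x = f <;> simp [hxe, hxf, hfB]
  by_cases hez : G.Adj e z
  · by_cases hfz : G.Adj f z
    · refine le_of_eq_of_le ?_ hz
      refine card_bij' (fun x _ => Equiv.swap e f x) (fun x _ => Equiv.swap e f x) ?_ ?_
        (by simp) (by simp)
      · intro x hx
        rw [mem_filter, SimpleGraph.mem_neighborFinset] at hx ⊢
        by_cases hxe : x = e
        · subst hxe; simp [hfz.symm]
        · by_cases hxf : x = f
          · subst hxf; simp_all
          · simp_all [Equiv.swap_apply_of_ne_of_ne]
      · intro x hx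
        rw [mem_filter, SimpleGraph.mem_neighborFinset] at hx ⊢
        by_cases hxe : x = e
        · subst hxe; simp_all
        · by_cases hxf : x = f
          · subst hxf; simp [hez.symm]
          · simp_all [Equiv.swap_apply_of_ne_of_ne]
    · exfalso
      have hwz : w ≠ z := by rintro rfl; exact hfz hfw
      have hA : ((G.neighborFinset w).erase e).image c = Bᶜ :=
        hB.resolve_left fun h => hfB (h ▸ hfA)
      have hz' := (h.degree_and_image_compl he hc hwz hew hez).2
      have hz4 := (h.degree_and_image_compl he hc hwz.symm hez hew).1
      rw [hA, compl_compl] at hz'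
      have hsub : (G.neighborFinset z).erase e ⊆
          {x ∈ G.neighborFinset z | x = f ∨ Function.update c e (c f) x ∈ B} := by
        intro x hx
        have hxB : c x ∈ B := hz' ▸ mem_image_of_mem c hx
        rw [mem_erase] at hx
        simp [Function.update_of_ne hx.1, hxB, hx.2]
      have := card_le_card hsub
      rw [card_erase_of_mem (by simpa using hez.symm),
        SimpleGraph.card_neighborFinset_eq_degree] at this
      omega
  · refine le_trans (card_le_card fun x hx => ?_) hz
    rw [mem_filter, SimpleGraph.mem_neighborFinset] at hx ⊢
    have hxe : x ≠ e := by rintro rfl; exact hez hx.1.symm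
    simp_all

/-- If the color conflict at `e` can be moved to `g` along linked vertices, then the two
neighbors of `g` almost avoid complementary parts of the palette. -/
theorem exists_almostAvoids (h : IsInjCritical G D) {e g : V}
    (heg : Relation.ReflTransGen (TwoFourLinked G) e g) (hg : IsTwoFour G g)
    {B : Finset (Fin (D + 2))} {c : V → Fin (D + 2)} (hc : IsInjColoringOff G c {e})
    (hB : ∀ w, G.Adj e w → ((G.neighborFinset w).erase e).image c = B ∨
      ((G.neighborFinset w).erase e).image c = Bᶜ) :
    ∃ w w', w ≠ w' ∧ G.neighborFinset g = {w, w'} ∧ 4 ≤ G.degree w ∧ 4 ≤ G.degree w' ∧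
      AlmostAvoids G c e B w ∧ AlmostAvoids G c e Bᶜ w' := by
  induction heg using Relation.ReflTransGen.head_induction_on generalizing c with
  | refl =>
    have avoid : ∀ (A : Finset (Fin (D + 2))) w, G.Adj g w →
        ((G.neighborFinset w).erase g).image c = Aᶜ → AlmostAvoids G c g A w := by
      intro A w hw hA
      refine le_trans (card_le_card (t := {g}) fun x hx => ?_) (card_singleton g).le
      rw [mem_filter] at hx
      rw [mem_singleton]
      by_contra hxg
      have := mem_image_of_mem c (mem_erase.2 ⟨hxg, hx.1⟩)
      rw [hA, mem_compl] at this
      exact this (hx.2.resolve_left hxg)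
    obtain ⟨w, w', hne, hN⟩ := card_eq_two.1 ((G.card_neighborFinset_eq_degree g).trans hg.1)
    have hw : G.Adj g w := by rw [← SimpleGraph.mem_neighborFinset, hN]; simp
    have hw' : G.Adj g w' := by rw [← SimpleGraph.mem_neighborFinset, hN]; simp
    obtain ⟨h4, hA'⟩ := h.degree_and_image_compl hg hc hne hw hw'
    obtain ⟨h4', -⟩ := h.degree_and_image_compl hg hc hne.symm hw' hw
    rcases hB w hw with hA | hA
    · rw [hA] at hA'
      exact ⟨w', w, hne.symm, by rw [hN, pair_comm], h4', h4, avoid _ _ hw' hA',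
        avoid _ _ hw (by rw [hA, compl_compl])⟩
    · rw [hA] at hA'
      exact ⟨w, w', hne, hN, h4, h4', avoid _ _ hw hA, avoid _ _ hw' hA'⟩
  | @head e f hef _ ih =>
    obtain ⟨he, hf, hne, w, hew, hfw⟩ := hef
    have hc' := h.off_update_of_linked he hc hne hew hfw
    have himg : ((G.neighborFinset w).erase f).image (Function.update c e (c f)) =
        ((G.neighborFinset w).erase e).image c := by
      ext α
      simp only [mem_image, mem_erase, SimpleGraph.mem_neighborFinset]
      constructor
      · rintro ⟨x, ⟨hxf, hx⟩, rfl⟩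
        by_cases hxe : x = e
        · exact ⟨f, ⟨hne.symm, hfw.symm⟩, by simp [hxe]⟩
        · exact ⟨x, ⟨hxe, hx⟩, by simp [hxe]⟩
      · rintro ⟨x, ⟨hxe, hx⟩, rfl⟩
        by_cases hxf : x = f
        · exact ⟨e, ⟨hne, hew.symm⟩, by simp [hxf]⟩
        · exact ⟨x, ⟨hxf, hx⟩, by simp [hxe]⟩
    have hBw := hB w hew
    obtain ⟨u, u', huu, hN, h4, h4', hu, hu'⟩ := ih hc' (by
      intro z hz
      by_cases hzw : w = z
      · subst hzw
        rwa [himg]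
      · rw [(h.degree_and_image_compl hf hc' hzw hfw hz).2, himg]
        rcases hBw with hA | hA <;> simp [hA])
    exact ⟨u, u', huu, hN, h4, h4', h.almostAvoids_of_update he hc hne hew hfw hBw hu,
      h.almostAvoids_of_update he hc hne hew hfw (by rwa [compl_compl, or_comm]) hu'⟩

theorem exists_forall_almostAvoids (h : IsInjCritical G D) {e : V} (he : IsTwoFour G e)
    {c : V → Fin (D + 2)} (hc : IsInjColoringOff G c {e}) :
    ∃ B : Finset (Fin (D + 2)), ∀ g, Relation.ReflTransGen (TwoFourLinked G) e g →
      IsTwoFour G g → ∃ w w', w ≠ w' ∧ G.neighborFinset g = {w, w'} ∧ 4 ≤ G.degree w ∧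
        4 ≤ G.degree w' ∧ AlmostAvoids G c e B w ∧ AlmostAvoids G c e Bᶜ w' := by
  obtain ⟨u, hu, -⟩ := he.2
  refine ⟨((G.neighborFinset u).erase e).image c, fun g heg hg =>
    h.exists_almostAvoids heg hg hc fun w hw => ?_⟩
  by_cases huw : u = w
  · exact Or.inl (by rw [huw])
  · exact Or.inr (h.degree_and_image_compl he hc huw hu hw).2

end IsInjCritical

theorem not_almostAvoids_compl {c : V → Fin k} {e : V} {B : Finset (Fin k)} {w : V}
    (hw : 4 ≤ G.degree w) (h : AlmostAvoids G c e B w) : ¬ AlmostAvoids G c e Bᶜ w := by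
  intro h'
  unfold AlmostAvoids at h h'
  have hsub : G.neighborFinset w ⊆ {x ∈ G.neighborFinset w | x = e ∨ c x ∈ B} ∪
      {x ∈ G.neighborFinset w | x = e ∨ c x ∈ Bᶜ} := by
    intro x hx
    rw [mem_union, mem_filter, mem_filter, mem_compl]
    tauto
  have := (card_le_card hsub).trans (card_union_le _ _)
  rw [SimpleGraph.card_neighborFinset_eq_degree] at this
  omega

/-- The bipartite graph between the vertices satisfying `IsTwoFour` and the other ones. -/
def twoFourGraph (G : SimpleGraph V) [DecidableRel G.Adj] : SimpleGraph V where
  Adj a b := G.Adj a b ∧ ¬ (IsTwoFour G a ↔ IsTwoFour G b)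
  symm := ⟨fun _ _ h => ⟨h.1.symm, fun h' => h.2 h'.symm⟩⟩
  loopless := ⟨fun _ h => h.2 Iff.rfl⟩

theorem linked_of_reachable {e v : V} (he : IsTwoFour G e)
    (h : (twoFourGraph G).Reachable e v) :
    (IsTwoFour G v → Relation.ReflTransGen (TwoFourLinked G) e v) ∧
    (¬ IsTwoFour G v → ∃ g, IsTwoFour G g ∧ G.Adj g v ∧
      Relation.ReflTransGen (TwoFourLinked G) e g) := by
  rw [SimpleGraph.reachable_iff_reflTransGen] at h
  induction h with
  | refl => exact ⟨fun _ => .refl, fun h => absurd he h⟩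
  | @tail v v' _ hvv' ih =>
    obtain ⟨hadj, hne⟩ := hvv'
    refine ⟨fun hv' => ?_, fun hv' => ?_⟩
    · obtain ⟨g, hg, hgv, heg⟩ := ih.2 (by tauto)
      by_cases hgv' : g = v'
      · exact hgv' ▸ heg
      · exact heg.tail ⟨hg, hv', hgv', v, hgv, hadj.symm⟩
    · exact ⟨v, by tauto, hadj, ih.1 (by tauto)⟩

namespace IsInjCritical

theorem finalCharge_nonneg_of_degree_eq_two (h : IsInjCritical G D) {v : V}
    (hv : G.degree v = 2) : 0 ≤ finalCharge G v := by
  have : ∀ u ∈ G.neighborFinset v, gift G u v - gift G v u = 2 := by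
    intro u hu
    have := h.three_le_degree_of_adj hv ((G.mem_neighborFinset _ _).1 hu)
    unfold gift
    split_ifs <;> omega
  rw [finalCharge, sum_congr rfl this, sum_const, SimpleGraph.card_neighborFinset_eq_degree,
    initialCharge]
  simp [hv]

theorem finalCharge_nonneg_of_degree_eq_three (h : IsInjCritical G D) {v : V}
    (hv : G.degree v = 3) : 0 ≤ finalCharge G v := by
  have h4 := h.four_le
  rw [finalCharge, initialCharge, if_neg (by omega), hv]
  by_cases hx : ∃ x, G.Adj v x ∧ G.degree x = 2
  · obtain ⟨x, hvx, hx⟩ := hx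
    have hxv := h.conflictBound_le_of_degree_eq_two hx hvx.symm
    have hlt := h.conflictBound_lt hvx.symm (by omega)
    have hxN : x ∈ G.neighborFinset v := by simpa using hvx
    have hcard : #((G.neighborFinset v).erase x) = 2 := by
      rw [card_erase_of_mem hxN, SimpleGraph.card_neighborFinset_eq_degree, hv]
    obtain ⟨p, q, hpq, hN⟩ := card_eq_two.1 hcard
    rw [conflictBound, ← add_sum_erase _ _ hxN, hN, sum_pair hpq] at hlt
    rw [← add_sum_erase _ _ hxN, hN, sum_pair hpq]
    have hp := h.degree_le p
    have hq := h.degree_le q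
    unfold gift
    split_ifs <;> omega
  · push Not at hx
    have : 0 ≤ ∑ u ∈ G.neighborFinset v, (gift G u v - gift G v u) := by
      refine sum_nonneg fun u hu => ?_
      have := hx u ((G.mem_neighborFinset _ _).1 hu)
      unfold gift
      split_ifs <;> omega
    push_cast
    omega

theorem exists_isTwoFour_of_finalCharge_neg (h : IsInjCritical G D) {v : V}
    (hv : finalCharge G v < 0) :
    ∃ e, G.Adj v e ∧ IsTwoFour G e ∧ ¬ IsTwoFour G v ∧ conflictBound G v ≤ D + 1 := by
  have hD := h.four_le
  have h0 : G.degree v ≠ 0 := by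
    intro h0
    have : G.neighborFinset v = ∅ := by
      rw [← card_eq_zero, SimpleGraph.card_neighborFinset_eq_degree, h0]
    simp [finalCharge, initialCharge, h0, this] at hv
  have h1 := h.degree_ne_one v
  have h2 : G.degree v ≠ 2 := fun h2 => by
    have := h.finalCharge_nonneg_of_degree_eq_two h2
    omega
  have h3 : G.degree v ≠ 3 := fun h3 => by
    have := h.finalCharge_nonneg_of_degree_eq_three h3
    omega
  have hle := le_finalCharge_of_four_le G (v := v) (by omega)
  have hcard := (card_filter_le (G.neighborFinset v) fun u => G.degree u = 2).trans_eq
    (G.card_neighborFinset_eq_degree v)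
  have h4 : G.degree v = 4 := by omega
  have hpos : 0 < #{u ∈ G.neighborFinset v | G.degree u = 2} := by omega
  obtain ⟨e, he⟩ := card_pos.1 hpos
  rw [mem_filter, SimpleGraph.mem_neighborFinset] at he
  refine ⟨e, he.1, ⟨he.2, v, he.1.symm, h4⟩, fun hv => h2 hv.1, ?_⟩
  have hgift : ∀ u, gift G u v = 0 := by
    intro u
    unfold gift
    split_ifs <;> omega
  have hsum : 7 ≤ ∑ u ∈ G.neighborFinset v, gift G v u := by
    rw [finalCharge, initialCharge, if_neg h0, h4] at hv
    simp only [hgift, zero_sub, sum_neg_distrib] at hv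
    push_cast at hv
    omega
  have hgift_le : ∀ u, gift G v u ≤ 2 := by
    intro u
    unfold gift
    split_ifs <;> omega
  have hsmall : ∀ u ∈ G.neighborFinset v, G.degree u ≤ 3 := by
    intro u hu
    by_contra! hlt
    rw [← add_sum_erase _ _ hu] at hsum
    have h5 : ∑ u ∈ (G.neighborFinset v).erase u, gift G v u ≤ _ :=
      sum_le_card_nsmul _ _ 2 fun u _ => hgift_le u
    rw [card_erase_of_mem hu, SimpleGraph.card_neighborFinset_eq_degree, h4] at h5
    have : gift G v u = 0 := by
      unfold gift
      split_ifs <;> omega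
    simp only [Nat.add_one_sub_one, nsmul_eq_mul] at h5
    push_cast at h5
    omega
  have hcongr : ((conflictBound G v : ℕ) : ℤ) + ∑ u ∈ G.neighborFinset v, gift G v u
      ≤ ∑ u ∈ G.neighborFinset v, 3 := by
    rw [conflictBound, Nat.cast_sum, ← sum_add_distrib]
    refine sum_le_sum fun u hu => ?_
    have := hsmall u hu
    have hu0 := (G.degree_pos_iff_exists_adj u).2 ⟨v, ((G.mem_neighborFinset _ _).1 hu).symm⟩
    have hu1 := h.degree_ne_one u
    unfold gift
    split_ifs <;> omega
  rw [sum_const, SimpleGraph.card_neighborFinset_eq_degree, h4] at hcongr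
  simp only [nsmul_eq_mul] at hcongr
  push_cast at hcongr
  omega

theorem sum_finalCharge_nonneg (h : IsInjCritical G D) {e : V} (he : IsTwoFour G e)
    {c : V → Fin (D + 2)} (hc : IsInjColoringOff G c {e}) {S : Finset V}
    (hS : ∀ v, v ∈ S ↔ (twoFourGraph G).Reachable e v) : 0 ≤ ∑ v ∈ S, finalCharge G v := by
  classical
  obtain ⟨B, hB⟩ := h.exists_forall_almostAvoids he hc
  set X := {v ∈ S | IsTwoFour G v} with hX
  set P := {v ∈ S | ¬ IsTwoFour G v} with hP
  have hXB : ∀ g ∈ X, _ := fun g hg =>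
    hB g ((linked_of_reachable he ((hS g).1 (mem_filter.1 hg).1)).1 (mem_filter.1 hg).2)
      (mem_filter.1 hg).2
  have hstep : ∀ a ∈ S, ∀ b, G.Adj a b → ¬ (IsTwoFour G a ↔ IsTwoFour G b) → b ∈ S :=
    fun a ha b hab hne => (hS b).2 (((hS a).1 ha).trans (SimpleGraph.Adj.reachable ⟨hab, hne⟩))
  have hXN : ∀ g ∈ X, ∀ w, G.Adj g w → 4 ≤ G.degree w ∧ w ∈ P := by
    intro g hg w hgw
    obtain ⟨a, a', -, hN, ha, ha', -⟩ := hXB g hg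
    have : w ∈ G.neighborFinset g := by simpa using hgw
    rw [hN, mem_insert, mem_singleton] at this
    have hw : 4 ≤ G.degree w := by rcases this with rfl | rfl <;> assumption
    have hM : ¬ IsTwoFour G w := fun hM => by have := hM.1; omega
    rw [mem_filter] at hg
    exact ⟨hw, mem_filter.2 ⟨hstep g hg.1 w hgw (by tauto), hM⟩⟩
  have hPX : ∀ w ∈ P, ∃ g ∈ X, G.Adj g w := by
    intro w hw
    rw [mem_filter] at hw
    obtain ⟨g, hg, hgw, -⟩ := (linked_of_reachable he ((hS w).1 hw.1)).2 hw.2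
    exact ⟨g, mem_filter.2 ⟨hstep w hw.1 g hgw.symm (by tauto), hg⟩, hgw⟩
  have hXP : #X ≤ #P := by
    let spec : V → Finset V := fun w =>
      if AlmostAvoids G c e B w then {x ∈ G.neighborFinset w | x = e ∨ c x ∈ B}
      else if AlmostAvoids G c e Bᶜ w then {x ∈ G.neighborFinset w | x = e ∨ c x ∈ Bᶜ}
      else ∅
    have hspec : ∀ w ∈ P, #(spec w) ≤ 1 := by
      intro w _
      simp only [spec]
      split_ifs with h1 h2
      · exact h1
      · exact h2
      · simp
    refine (card_le_card fun g hg => ?_).trans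
      ((card_biUnion_le_card_mul P spec 1 hspec).trans_eq (mul_one _))
    obtain ⟨w, w', -, hN, hw, hw', hBw, hBw'⟩ := hXB g hg
    have hgw : G.Adj g w := by rw [← SimpleGraph.mem_neighborFinset, hN]; simp
    have hgw' : G.Adj g w' := by rw [← SimpleGraph.mem_neighborFinset, hN]; simp
    rw [mem_biUnion]
    by_cases hgB : c g ∈ B
    · refine ⟨w, (hXN g hg w hgw).2, ?_⟩
      simp [spec, hBw, hgB, hgw.symm]
    · refine ⟨w', (hXN g hg w' hgw').2, ?_⟩
      have : ¬ AlmostAvoids G c e B w' := fun h => not_almostAvoids_compl hw' h hBw'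
      simp [spec, this, hBw', hgB, hgw'.symm]
  have hcount : ∑ w ∈ P, #{x ∈ X | G.Adj x w} = 2 * #X := by
    refine (sum_card_bipartiteAbove_eq_sum_card_bipartiteBelow fun w x => G.Adj x w).trans ?_
    rw [mul_comm]
    refine sum_const_nat fun g hg => ?_
    rw [← (mem_filter.1 hg).2.1, ← SimpleGraph.card_neighborFinset_eq_degree]
    congr 1
    ext w
    rw [mem_bipartiteBelow, SimpleGraph.mem_neighborFinset]
    exact ⟨fun h => h.2, fun h => ⟨(hXN g hg w h).2, h⟩⟩
  have hcharge : ∀ w ∈ P, (2 : ℤ) - #{x ∈ X | G.Adj x w} ≤ finalCharge G w := by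
    intro w hw
    obtain ⟨g, hg, hgw⟩ := hPX w hw
    have hpos : 0 < #{x ∈ X | G.Adj x w} := card_pos.2 ⟨g, mem_filter.2 ⟨hg, hgw⟩⟩
    have hw4 := (hXN g hg w hgw).1
    have hle := le_finalCharge_of_four_le G hw4
    have hcard := (card_filter_le (G.neighborFinset w) fun u => G.degree u = 2).trans_eq
      (G.card_neighborFinset_eq_degree w)
    by_cases hw5 : G.degree w = 4
    · have hsub : {u ∈ G.neighborFinset w | G.degree u = 2} ⊆ {x ∈ X | G.Adj x w} := by
        intro u hu
        rw [mem_filter, SimpleGraph.mem_neighborFinset] at hu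
        have hu' : IsTwoFour G u := ⟨hu.2, w, hu.1.symm, hw5⟩
        rw [mem_filter] at hw
        exact mem_filter.2 ⟨mem_filter.2 ⟨hstep w hw.1 u hu.1 (by tauto), hu'⟩, hu.1.symm⟩
      have := card_le_card hsub
      omega
    · omega
  have h1 : 0 ≤ ∑ v ∈ X, finalCharge G v :=
    sum_nonneg fun v hv => h.finalCharge_nonneg_of_degree_eq_two (mem_filter.1 hv).2.1
  have h2 := sum_le_sum hcharge
  rw [sum_sub_distrib, sum_const, ← Nat.cast_sum, hcount] at h2
  have h3 := sum_filter_add_sum_filter_not S (IsTwoFour G) (finalCharge G)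
  simp only [nsmul_eq_mul] at h2
  push_cast at h2
  rw [← hX, ← hP] at h3
  omega

theorem sum_initialCharge_nonneg (h : IsInjCritical G D) : 0 ≤ ∑ v, initialCharge G v := by
  classical
  rw [← sum_finalCharge,
    ← sum_fiberwise univ (twoFourGraph G).connectedComponentMk (finalCharge G)]
  refine sum_nonneg fun C _ => ?_
  by_contra! hneg
  obtain ⟨v, hv, hlt⟩ := exists_lt_of_sum_lt (by simpa using hneg :
    _ < ∑ v ∈ univ with (twoFourGraph G).connectedComponentMk v = C, (0 : ℤ))
  obtain ⟨e, hve, he, hv', hv4⟩ := h.exists_isTwoFour_of_finalCharge_neg hlt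
  obtain ⟨c, hc⟩ := h.exists_off hve hv4
  refine hneg.not_ge (h.sum_finalCharge_nonneg he hc fun u => ?_)
  have hCe : (twoFourGraph G).connectedComponentMk e = C := by
    rw [← (mem_filter.1 hv).2, SimpleGraph.ConnectedComponent.eq]
    exact SimpleGraph.Adj.reachable ⟨hve.symm, by tauto⟩
  rw [mem_filter, ← hCe, SimpleGraph.ConnectedComponent.eq, SimpleGraph.reachable_comm]
  simp

end IsInjCritical

/-- If every nonempty subgraph of `G` has average degree less than `14 / 5`, then every spanning
subgraph with an edge has negative total initial charge. -/
theorem sum_initialCharge_neg {V : Type*} [Fintype V] {G H : SimpleGraph V}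
    [DecidableRel H.Adj] (hHG : H ≤ G)
    (hmad : ∀ H : G.Subgraph, H.verts.Nonempty →
      (2 * H.edgeSet.ncard : ℚ) / H.verts.ncard < 14 / 5)
    (hne : H ≠ ⊥) : ∑ v, initialCharge H v < 0 := by
  classical
  let K : G.Subgraph :=
    { verts := H.support
      Adj := H.Adj
      adj_sub := fun h => hHG h
      edge_vert := fun h => ⟨_, h⟩
      symm := H.symm }
  obtain ⟨a, b, hab⟩ := SimpleGraph.ne_bot_iff_exists_adj.1 hne
  have hpos : 0 < K.verts.ncard := (Set.ncard_pos (Set.toFinite _)).2 ⟨a, b, hab⟩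
  have hlt := hmad K ⟨a, b, hab⟩
  have hedge : K.edgeSet.ncard = #H.edgeFinset := by
    rw [← Set.ncard_coe_finset, SimpleGraph.coe_edgeFinset]
    congr 1
  have hverts : K.verts.ncard = #{v | H.degree v ≠ 0} := by
    rw [← Set.ncard_coe_finset]
    congr 1
    ext v
    simp [K, SimpleGraph.mem_support, ← Nat.pos_iff_ne_zero, H.degree_pos_iff_exists_adj]
  have hsum : ∑ v, initialCharge H v =
      5 * (2 * #H.edgeFinset : ℕ) - 14 * #{v | H.degree v ≠ 0} := by
    rw [← SimpleGraph.sum_degrees_eq_twice_card_edges, card_filter]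
    push_cast
    rw [mul_sum, mul_sum, ← sum_sub_distrib]
    refine sum_congr rfl fun v _ => ?_
    unfold initialCharge
    split_ifs <;> simp_all
  rw [div_lt_div_iff₀ (by exact_mod_cast hpos) (by norm_num), hedge, hverts] at hlt
  have : 2 * #H.edgeFinset * 5 < 14 * #{v | H.degree v ≠ 0} := by exact_mod_cast hlt
  omega

end

/-- If `Δ(G) ≥ 4` and `mad(G) < 14/5`, then `χᵢ(G) ≤ Δ(G) + 2`. -/
theorem injChromNum_le_of_maxDegree_ge_four_of_mad_lt {V : Type*} [Fintype V]
    (G : SimpleGraph V) [DecidableRel G.Adj]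
    (hΔ : 4 ≤ G.maxDegree)
    (hmad : ∀ H : G.Subgraph, H.verts.Nonempty →
      (2 * H.edgeSet.ncard : ℚ) / H.verts.ncard < 14 / 5) :
    injChromNum G ≤ G.maxDegree + 2 := by
  classical
  have hcol : ∀ H ≤ G, ∃ c : V → Fin (G.maxDegree + 2), IsInjColoring H c := by
    intro H
    induction H using WellFoundedLT.induction with
    | ind H ih =>
      intro hHG
      by_contra hnot
      have hcrit : IsInjCritical H G.maxDegree := {
        four_le := hΔ
        degree_le := fun v => (SimpleGraph.degree_le_of_le hHG).trans (G.degree_le_maxDegree v)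
        not_colorable := hnot
        deleteEdge_colorable := fun u v huv => by
          have hle : H.deleteEdges {s(u, v)} ≤ H := H.deleteEdges_le _
          refine ih _ (lt_of_le_of_ne hle fun heq => ?_) (hle.trans hHG)
          rw [← heq] at huv
          simp [SimpleGraph.deleteEdges_adj] at huv }
      refine (sum_initialCharge_neg hHG hmad ?_).not_ge hcrit.sum_initialCharge_nonneg
      rintro rfl
      exact hnot ⟨fun _ => 0, fun u v _ h => by simp at h⟩
  exact Nat.sInf_le (hcol G le_rfl)
end

section
/- Let G be a finite simple graph with maximum degree Δ(G) = 5. If mad(G) < 14/5, then the injective chromatic number of G satisfies χ_i(G) ≤ 7. -/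
open SimpleGraph

open Finset

/-- Cycles of even length are list-colorable from lists of size two; the cycle is presented as a
periodic sequence. -/
theorem exists_periodic_choice_ne_succ {α : Type*} [DecidableEq α] {m : ℕ} (hm : 0 < m)
    {L : ℕ → Finset α} (hper : ∀ i j, i ≡ j [MOD 2 * m] → L i = L j) (hL : ∀ j, 2 ≤ #(L j)) :
    ∃ f : ℕ → α, (∀ i j, i ≡ j [MOD 2 * m] → f i = f j) ∧ (∀ j, f j ∈ L j) ∧
      ∀ j, f j ≠ f (j + 1) := by
  by_cases hsub : ∀ j, L (j + 1) ⊆ L j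
  · have hanti : Antitone L := antitone_nat_of_succ_le hsub
    have hconst : ∀ j, L 0 = L j := fun j ↦
      le_antisymm ((hper 0 (j * (2 * m)) (by simp [Nat.ModEq])).le.trans
        (hanti (Nat.le_mul_of_pos_right j (by lia)))) (hanti (Nat.zero_le j))
    obtain ⟨a, ha, b, hb, hab⟩ := Finset.one_lt_card.mp (hL 0)
    refine ⟨fun j ↦ if j % 2 = 0 then a else b, fun i j hij ↦ ?_, fun j ↦ ?_, fun j ↦ ?_⟩
    · have : i % 2 = j % 2 := hij.of_dvd (Dvd.intro m rfl)
      simp only [this]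
    · rw [← hconst j]
      dsimp only
      split_ifs <;> assumption
    · rcases Nat.mod_two_eq_zero_or_one j with h | h
      · simp [h, Nat.add_mod, hab]
      · simp [h, Nat.add_mod, hab.symm]
  · push Not at hsub
    obtain ⟨k, hk⟩ := hsub
    obtain ⟨x, hx, hxk⟩ := Finset.not_subset.mp hk
    have hnext : ∀ (j : ℕ) (y : α), ∃ z ∈ L j, z ≠ y := fun j y ↦
      Finset.exists_mem_ne (hL j) y
    choose next hmem hne using hnext
    let h : ℕ → α := fun t ↦ Nat.rec x (fun s y ↦ next (k + 1 + (s + 1)) y) t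
    have h_mem : ∀ t, h t ∈ L (k + 1 + t) := by
      rintro (_ | t)
      · exact hx
      · exact hmem _ _
    have h_ne : ∀ t, h (t + 1) ≠ h t := fun t ↦ hne _ _
    obtain ⟨c, hc⟩ : ∃ c, k + 1 + c = 2 * m * (k + 1) :=
      ⟨2 * m * (k + 1) - (k + 1), Nat.add_sub_cancel' (Nat.le_mul_of_pos_left _ (by lia))⟩
    have hmod : ∀ j, k + 1 + (j + c) % (2 * m) ≡ j [MOD 2 * m] := fun j ↦ by
      have h1 : k + 1 + (j + c) % (2 * m) ≡ k + 1 + (j + c) [MOD 2 * m] :=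
        (Nat.mod_modEq _ _).add_left _
      have h2 : k + 1 + (j + c) = j + 2 * m * (k + 1) := by lia
      rw [h2] at h1
      exact h1.trans (by simp [Nat.ModEq])
    refine ⟨fun j ↦ h ((j + c) % (2 * m)), fun i j hij ↦ ?_, fun j ↦ ?_, fun j ↦ ?_⟩
    · exact congrArg h (hij.add_right c)
    · rw [← hper _ _ (hmod j)]
      exact h_mem _
    · dsimp only
      have hlt : (j + c) % (2 * m) < 2 * m := Nat.mod_lt _ (by lia)
      rw [show j + 1 + c = j + c + 1 by lia, Nat.add_mod (j + c) 1]
      rcases Nat.lt_or_ge ((j + c) % (2 * m) + 1) (2 * m) with hl | hl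
      · rw [Nat.mod_eq_of_lt (show 1 < 2 * m by lia), Nat.mod_eq_of_lt hl]
        exact (h_ne _).symm
      · have heq : (j + c) % (2 * m) = 2 * m - 1 := by lia
        rw [Nat.mod_eq_of_lt (show 1 < 2 * m by lia), heq, show 2 * m - 1 + 1 = 2 * m by lia,
          Nat.mod_self]
        intro hcon
        have h1 := h_mem (2 * m - 1)
        rw [hcon, hper (k + 1 + (2 * m - 1)) k] at h1
        · exact hxk h1
        · rw [show k + 1 + (2 * m - 1) = k + 2 * m by lia]
          simp [Nat.ModEq]

namespace SimpleGraph

variable {V : Type*} [Fintype V]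

theorem IsAcyclic.card_edgeFinset_lt_card [Nonempty V] {G : SimpleGraph V} [DecidableRel G.Adj]
    (hG : G.IsAcyclic) : #G.edgeFinset < Fintype.card V := by
  classical
  obtain ⟨T, hGT, hT⟩ := exists_maximal_isAcyclic_of_le_isAcyclic le_top hG
  have htree : T.IsTree := by
    rw [← maximal_isAcyclic_iff_isTree]
    simpa using hT
  rw [← htree.card_edgeFinset]
  exact Nat.lt_succ_of_le (card_le_card (edgeFinset_mono hGT))

theorem IsAcyclic.card_edgeFinset_le_card_of_support_subset {G : SimpleGraph V}
    [DecidableRel G.Adj] (hG : G.IsAcyclic) {S : Finset V} (hS : G.support ⊆ S) :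
    #G.edgeFinset ≤ #S := by
  classical
  have h := map_edgeFinset_induce_of_support_subset hS
  rw [← h, card_map]
  rcases S.eq_empty_or_nonempty with rfl | hne
  · have : IsEmpty ((∅ : Finset V) : Set V) := by simp
    simp [Subsingleton.elim (G.induce ((∅ : Finset V) : Set V)) ⊥]
  · have : Nonempty (S : Set V) := hne.to_subtype
    have hlt := (hG.induce (S : Set V)).card_edgeFinset_lt_card
    have hS' : Fintype.card (S : Set V) = #S := by simp
    convert Nat.le_of_lt (hlt.trans_eq hS')

/-- A graph that is not acyclic contains a cycle, listed as a periodic sequence of vertices. -/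
theorem exists_periodic_of_not_isAcyclic {V : Type*} {G : SimpleGraph V} (hG : ¬ G.IsAcyclic) :
    ∃ n, 3 ≤ n ∧ ∃ g : ℕ → V, (∀ i j, g i = g j ↔ i ≡ j [MOD n]) ∧
      ∀ i, G.Adj (g i) (g (i + 1)) := by
  rw [isAcyclic_iff_free_cycleGraph] at hG
  push Not at hG
  obtain ⟨n, hn, ⟨φ⟩⟩ := hG
  obtain ⟨k, rfl⟩ : ∃ k, n = k + 2 := ⟨n - 2, by lia⟩
  refine ⟨k + 2, hn, fun i ↦ φ (Fin.ofNat (k + 2) i), fun i j ↦ ?_, fun i ↦ ?_⟩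
  · refine φ.injective.eq_iff.trans ?_
    simp [Fin.ext_iff, Nat.ModEq]
  · refine φ.toHom.map_adj ?_
    rw [cycleGraph_adj]
    right
    rw [sub_eq_iff_eq_add]
    ext
    simp [Fin.val_add, add_comm]

section InjColoring

/-- `c` is an injective coloring of `G` as far as vertices outside `U` are concerned. -/
def IsInjColoringOff {V α : Type*} (G : SimpleGraph V) (U : Set V) (c : V → α) : Prop :=
  ∀ ⦃u v : V⦄, u ∉ U → v ∉ U → u ≠ v → (∃ w, G.Adj u w ∧ G.Adj v w) → c u ≠ c v

theorem isInjColoringOff_empty {V α : Type*} {G : SimpleGraph V} {c : V → α} :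
    G.IsInjColoringOff ∅ c ↔ IsInjColoring G c := by
  simp [IsInjColoringOff, IsInjColoring]

theorem IsInjColoringOff.mono {V α : Type*} {G : SimpleGraph V} {U U' : Set V} {c : V → α}
    (h : G.IsInjColoringOff U c) (hU : U ⊆ U') : G.IsInjColoringOff U' c :=
  fun _ _ hu hv ↦ h (fun h' ↦ hu (hU h')) (fun h' ↦ hv (hU h'))

theorem IsInjColoringOff.of_deleteEdges {V α : Type*} {G : SimpleGraph V} {u v : V} {c : V → α}
    (hc : IsInjColoring (G.deleteEdges {s(u, v)}) c) : G.IsInjColoringOff {u, v} c := by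
  rintro x y hx hy hxy ⟨w, hxw, hyw⟩
  refine hc hxy ⟨w, ?_, ?_⟩ <;> rw [deleteEdges_adj] <;> grind

variable [DecidableEq V] (G : SimpleGraph V) [DecidableRel G.Adj]

/-- The vertices other than `v` that share a neighbor with `v`. -/
def injNeighborFinset (v : V) : Finset V :=
  (G.neighborFinset v).biUnion fun w ↦ (G.neighborFinset w).erase v

variable {G}

theorem mem_injNeighborFinset {u v : V} :
    u ∈ G.injNeighborFinset v ↔ u ≠ v ∧ ∃ w, G.Adj u w ∧ G.Adj v w := by
  simp only [injNeighborFinset, mem_biUnion, mem_neighborFinset, mem_erase]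
  constructor
  · rintro ⟨w, h1, h2, h3⟩
    exact ⟨h2, w, h3.symm, h1⟩
  · rintro ⟨h, w, h1, h2⟩
    exact ⟨w, h2, h, h1.symm⟩

theorem card_injNeighborFinset_le (v : V) :
    #(G.injNeighborFinset v) ≤ ∑ w ∈ G.neighborFinset v, (G.degree w - 1) := by
  refine card_biUnion_le.trans (sum_le_sum fun w hw ↦ ?_)
  rw [mem_neighborFinset] at hw
  rw [card_erase_of_mem (by simpa using hw.symm), card_neighborFinset_eq_degree]

theorem IsInjColoringOff.extend {k : ℕ} {U : Set V} {c : V → Fin k} {v : V}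
    (hc : G.IsInjColoringOff (insert v U) c) (hv : #(G.injNeighborFinset v) < k) :
    ∃ c' : V → Fin k, G.IsInjColoringOff U c' := by
  obtain ⟨x, -, hx⟩ : ∃ x ∈ (univ : Finset (Fin k)), x ∉ (G.injNeighborFinset v).image c :=
    exists_mem_notMem_of_card_lt_card (by simpa using card_image_le.trans_lt hv)
  have hx' : ∀ u, u ≠ v → (∃ w, G.Adj u w ∧ G.Adj v w) → c u ≠ x := fun u hu hw h ↦
    hx (mem_image.mpr ⟨u, mem_injNeighborFinset.mpr ⟨hu, hw⟩, h⟩)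
  refine ⟨Function.update c v x, fun a b ha hb hab hw ↦ ?_⟩
  by_cases hav : a = v
  · subst hav
    rw [Function.update_self, Function.update_of_ne hab.symm]
    exact (hx' b hab.symm (by obtain ⟨w, h1, h2⟩ := hw; exact ⟨w, h2, h1⟩)).symm
  by_cases hbv : b = v
  · subst hbv
    rw [Function.update_self, Function.update_of_ne hab]
    exact hx' a hab hw
  rw [Function.update_of_ne hav, Function.update_of_ne hbv]
  exact hc (by simp [hav, ha]) (by simp [hbv, hb]) hab hw

end InjColoring

section Reducible

variable [DecidableEq V] {G : SimpleGraph V} [DecidableRel G.Adj]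

theorem deleteEdges_singleton_lt {V : Type*} {G : SimpleGraph V} {u v : V} (h : G.Adj u v) :
    G.deleteEdges {s(u, v)} < G := by
  refine lt_of_le_of_ne (deleteEdges_le _) fun heq ↦ ?_
  rw [← heq, deleteEdges_adj] at h
  exact h.2 rfl

theorem exists_isInjColoring_of_adj {k : ℕ}
    (ih : ∀ H < G, ∃ c : V → Fin k, IsInjColoring H c) {u v : V} (huv : G.Adj u v)
    (hu : #(G.injNeighborFinset u) < k) (hv : #(G.injNeighborFinset v) < k) :
    ∃ c : V → Fin k, IsInjColoring G c := by
  obtain ⟨c, hc⟩ := ih _ (deleteEdges_singleton_lt huv)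
  obtain ⟨c₁, hc₁⟩ := (IsInjColoringOff.of_deleteEdges hc).extend hu
  rw [← insert_empty_eq v] at hc₁
  obtain ⟨c₂, hc₂⟩ := hc₁.extend hv
  exact ⟨c₂, isInjColoringOff_empty.mp hc₂⟩

theorem exists_isInjColoring_of_degree_eq_one {k : ℕ}
    (ih : ∀ H < G, ∃ c : V → Fin k, IsInjColoring H c) {v : V} (hv : G.degree v = 1)
    (hk : #(G.injNeighborFinset v) < k) : ∃ c : V → Fin k, IsInjColoring G c := by
  obtain ⟨w, hw⟩ := card_eq_one.mp ((card_neighborFinset_eq_degree G v).trans hv)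
  have hN : ∀ x, G.Adj v x ↔ x = w := fun x ↦ by
    rw [← mem_neighborFinset, hw, mem_singleton]
  obtain ⟨c, hc⟩ := ih _ (deleteEdges_singleton_lt ((hN w).mpr rfl))
  have hoff : G.IsInjColoringOff (insert v ∅) c := by
    rintro x y hx hy hxy ⟨z, hxz, hyz⟩
    have hzv : z ≠ v := by
      rintro rfl
      exact hxy (((hN x).mp hxz.symm).trans ((hN y).mp hyz.symm).symm)
    refine hc hxy ⟨z, ?_, ?_⟩ <;> rw [deleteEdges_adj] <;> grind
  obtain ⟨c', hc'⟩ := hoff.extend hk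
  exact ⟨c', isInjColoringOff_empty.mp hc'⟩

/-- A cycle through 2-vertices at every other step is reducible when consecutive remaining vertices
have total degree at most `k + 2`. -/
theorem exists_isInjColoring_of_cycle {k : ℕ}
    (ih : ∀ H < G, ∃ c : V → Fin k, IsInjColoring H c) {m : ℕ} (hm : 0 < m) {g : ℕ → V}
    (hg : ∀ i j, g i = g j ↔ i ≡ j [MOD 4 * m]) (hadj : ∀ i, G.Adj (g i) (g (i + 1)))
    (hodd : ∀ i, G.degree (g (2 * i + 1)) = 2)
    (heven : ∀ i, G.degree (g (2 * i)) + G.degree (g (2 * i + 2)) ≤ k + 2)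
    (hzero : #(G.injNeighborFinset (g 0)) < k) : ∃ c : V → Fin k, IsInjColoring G c := by
  obtain ⟨c, hc⟩ := ih _ (deleteEdges_singleton_lt (hadj 0))
  set w : ℕ → V := fun j ↦ g (2 * j + 1) with hwdef
  have hdbl : ∀ i j, g (2 * i) = g (2 * j) ↔ i ≡ j [MOD 2 * m] := fun i j ↦ by
    rw [hg, show 4 * m = 2 * (2 * m) by lia, Nat.ModEq.mul_left_cancel_iff' (by lia)]
  have hww : ∀ i j, w i = w j ↔ i ≡ j [MOD 2 * m] := fun i j ↦ by
    rw [← hdbl, hg, hg]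
    exact ⟨fun h ↦ h.add_right_cancel' 1, fun h ↦ h.add_right 1⟩
  have hsucc : ∀ i, ¬ i ≡ i + 1 [MOD 2 * m] := fun i h ↦ by
    have h' := (Nat.modEq_iff_dvd' (Nat.le_succ i)).mp h
    rw [Nat.succ_eq_add_one, Nat.add_sub_cancel_left, Nat.dvd_one] at h'
    lia
  have hN : ∀ j x, G.Adj (w j) x ↔ x = g (2 * j) ∨ x = g (2 * j + 2) := fun j x ↦ by
    have hsub : {g (2 * j), g (2 * j + 2)} ⊆ G.neighborFinset (w j) := by
      intro y hy
      rw [mem_neighborFinset]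
      rcases mem_insert.mp hy with rfl | hy
      · exact (hadj (2 * j)).symm
      · rw [mem_singleton] at hy
        exact hy ▸ hadj (2 * j + 1)
    have hne : g (2 * j) ≠ g (2 * j + 2) := by
      rw [Ne, show 2 * j + 2 = 2 * (j + 1) by lia, hdbl]
      exact hsucc j
    have heq := eq_of_subset_of_card_le hsub (by
      rw [card_neighborFinset_eq_degree, hodd, card_pair hne])
    rw [← mem_neighborFinset, ← heq]
    simp
  set U : Set V := Set.range w with hU
  have hcU : G.IsInjColoringOff (insert (g 0) U) c :=
    (IsInjColoringOff.of_deleteEdges hc).mono (by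
      rintro x (rfl | rfl)
      · exact Set.mem_insert _ _
      · exact Set.mem_insert_of_mem _ ⟨0, rfl⟩)
  classical
  set F : V → Finset V := fun v ↦ {u ∈ G.injNeighborFinset v | u ∉ U} with hF
  have hcard : ∀ j, #(F (w j)) + 2 ≤ k := fun j ↦ by
    have hpreU : g (2 * j + 4 * m - 1) = w (j + 2 * m - 1) :=
      congrArg g (by lia)
    have hpre : G.Adj (g (2 * j)) (g (2 * j + 4 * m - 1)) := by
      have h := (hadj (2 * j + 4 * m - 1)).symm
      rwa [show 2 * j + 4 * m - 1 + 1 = 2 * j + 4 * m by lia,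
        (hg (2 * j + 4 * m) (2 * j)).mpr (by simp [Nat.ModEq])] at h
    have hsub : F (w j) ⊆
        G.neighborFinset (g (2 * j)) \ {w j, g (2 * j + 4 * m - 1)} ∪
          G.neighborFinset (g (2 * j + 2)) \ {w j, w (j + 1)} := by
      intro u hu
      obtain ⟨hu1, huU⟩ := mem_filter.mp hu
      obtain ⟨hne, x, hux, hx⟩ := mem_injNeighborFinset.mp hu1
      have hU' : ∀ i, u ≠ w i := fun i h ↦ huU ⟨i, h.symm⟩
      rcases (hN j x).mp hx with rfl | rfl
      · simp [hux.symm, hU', hpreU]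
      · simp [hux.symm, hU']
    have hs1 : {w j, g (2 * j + 4 * m - 1)} ⊆ G.neighborFinset (g (2 * j)) := by
      intro y hy
      rw [mem_neighborFinset]
      rcases mem_insert.mp hy with rfl | hy
      · exact hadj _
      · exact mem_singleton.mp hy ▸ hpre
    have hs2 : {w j, w (j + 1)} ⊆ G.neighborFinset (g (2 * j + 2)) := by
      intro y hy
      rw [mem_neighborFinset]
      rcases mem_insert.mp hy with rfl | hy
      · exact (hadj (2 * j + 1)).symm
      · exact mem_singleton.mp hy ▸ hadj (2 * j + 2)
    have hp1 : #({w j, g (2 * j + 4 * m - 1)} : Finset V) = 2 := by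
      rw [card_pair]
      rw [hpreU, Ne, hww]
      intro h
      refine hsucc j (Nat.ModEq.symm ?_)
      have h' := h.add_right 1
      rw [show j + 2 * m - 1 + 1 = j + 2 * m by lia] at h'
      exact h'.trans (by simp [Nat.ModEq])
    have hp2 : #({w j, w (j + 1)} : Finset V) = 2 := by
      rw [card_pair]
      rw [Ne, hww]
      exact hsucc j
    have h1 := card_sdiff_add_card_eq_card hs1
    have h2 := card_sdiff_add_card_eq_card hs2
    rw [card_neighborFinset_eq_degree] at h1 h2
    have h3 := (card_le_card hsub).trans (card_union_le _ _)
    have h4 := heven j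
    lia
  obtain ⟨f, hfper, hfL, hfne⟩ := exists_periodic_choice_ne_succ hm
    (L := fun j ↦ univ \ (F (w j)).image c)
    (fun i j hij ↦ by rw [(hww i j).mpr hij])
    (fun j ↦ by
      rw [card_sdiff_of_subset (subset_univ _), card_univ, Fintype.card_fin]
      have h1 := hcard j
      have h2 : #((F (w j)).image c) ≤ #(F (w j)) := card_image_le
      lia)
  let c' : V → Fin k := fun v ↦ if h : ∃ j, w j = v then f h.choose else c v
  have hc'w : ∀ j, c' (w j) = f j := fun j ↦ by
    have h : ∃ i, w i = w j := ⟨j, rfl⟩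
    simp only [c', dif_pos h]
    exact hfper _ _ ((hww _ _).mp h.choose_spec)
  have hc'U : ∀ v, v ∉ U → c' v = c v := fun v hv ↦ dif_neg hv
  have hmix : ∀ i v, v ∉ U → (∃ x, G.Adj v x ∧ G.Adj (w i) x) → f i ≠ c v := by
    intro i v hv hx heq
    have h := hfL i
    rw [mem_sdiff] at h
    refine h.2 (mem_image.mpr ⟨v, mem_filter.mpr ⟨mem_injNeighborFinset.mpr ⟨?_, hx⟩, hv⟩,
      heq.symm⟩)
    rintro rfl
    exact hv ⟨i, rfl⟩
  have hoff : G.IsInjColoringOff (insert (g 0) ∅) c' := by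
    rintro a b ha hb hab ⟨x, hax, hbx⟩
    by_cases haU : a ∈ U <;> by_cases hbU : b ∈ U
    · obtain ⟨i, rfl⟩ := haU
      obtain ⟨j, rfl⟩ := hbU
      rw [hc'w, hc'w]
      rw [Ne, hww] at hab
      have hcases : i ≡ j + 1 [MOD 2 * m] ∨ j ≡ i + 1 [MOD 2 * m] := by
        have h2 : ∀ i, 2 * i + 2 = 2 * (i + 1) := fun i ↦ by lia
        rcases (hN i x).mp hax with rfl | rfl <;> rcases (hN j _).mp hbx with h | h <;>
          simp only [h2, hdbl] at h
        · exact absurd h hab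
        · exact Or.inl h
        · exact Or.inr h.symm
        · exact absurd (h.add_right_cancel' 1) hab
      rcases hcases with h | h
      · rw [hfper _ _ h]
        exact (hfne j).symm
      · rw [hfper _ _ h]
        exact hfne i
    · obtain ⟨i, rfl⟩ := haU
      rw [hc'w, hc'U b hbU]
      exact hmix i b hbU ⟨x, hbx, hax⟩
    · obtain ⟨i, rfl⟩ := hbU
      rw [hc'w, hc'U a haU]
      exact (hmix i a haU ⟨x, hax, hbx⟩).symm
    · rw [hc'U a haU, hc'U b hbU]
      simp only [insert_empty_eq, Set.mem_singleton_iff] at ha hb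
      exact hcU (by simp [ha, haU]) (by simp [hb, hbU]) hab ⟨x, hax, hbx⟩
  obtain ⟨c₂, hc₂⟩ := hoff.extend hzero
  exact ⟨c₂, isInjColoringOff_empty.mp hc₂⟩

end Reducible

section Critical

variable (G : SimpleGraph V) [DecidableRel G.Adj]

/-- The number of walks `v, w, u` in `G` with `u ≠ v`. -/
def injDegree (v : V) : ℕ := ∑ w ∈ G.neighborFinset v, (G.degree w - 1)

/-- `G` has maximum degree at most five and is not injectively `7`-colorable, but all its proper
spanning subgraphs are. -/
structure IsInjCritical : Prop where
  degree_le : ∀ v, G.degree v ≤ 5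
  not_colorable : ¬ ∃ c : V → Fin 7, IsInjColoring G c
  of_lt : ∀ H < G, ∃ c : V → Fin 7, IsInjColoring H c

/-- The vertices of degree four whose neighbors have degrees `2, 2, 2, 2` or `2, 2, 2, 3`
(when `G` is critical). -/
def lightFinset : Finset V := {x | G.degree x = 4 ∧ G.injDegree x ≤ 5}

/-- The vertices of degree two with a light neighbor. -/
def lightNbrFinset : Finset V := {w | G.degree w = 2 ∧ ∃ x ∈ G.lightFinset, G.Adj w x}

variable {G}

theorem mem_lightFinset {x : V} :
    x ∈ G.lightFinset ↔ G.degree x = 4 ∧ G.injDegree x ≤ 5 := by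
  simp [lightFinset]

theorem mem_lightNbrFinset {w : V} :
    w ∈ G.lightNbrFinset ↔ G.degree w = 2 ∧ ∃ x ∈ G.lightFinset, G.Adj w x := by
  simp [lightNbrFinset]

variable [DecidableEq V]

theorem neighborFinset_eq_pair {u v w : V} (hw : G.degree w = 2) (hu : G.Adj w u)
    (hv : G.Adj w v) (huv : u ≠ v) : G.neighborFinset w = {u, v} := by
  refine (eq_of_subset_of_card_le ?_ ?_).symm
  · simp [insert_subset_iff, hu, hv]
  · rw [card_neighborFinset_eq_degree, hw, card_pair huv]

namespace IsInjCritical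

theorem seven_le_or (h : G.IsInjCritical) {u v : V}
    (huv : G.Adj u v) : 7 ≤ G.injDegree u ∨ 7 ≤ G.injDegree v := by
  by_contra! hlt
  exact h.not_colorable (exists_isInjColoring_of_adj h.of_lt huv
    ((card_injNeighborFinset_le u).trans_lt hlt.1) ((card_injNeighborFinset_le v).trans_lt hlt.2))

theorem injDegree_le (h : G.IsInjCritical) {v w : V} (hvw : G.Adj v w) :
    G.injDegree v ≤ (G.degree w - 1) + 4 * (G.degree v - 1) := by
  have hw : w ∈ G.neighborFinset v := by simpa using hvw
  rw [injDegree, ← add_sum_erase _ _ hw]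
  refine Nat.add_le_add_left ((sum_le_card_nsmul _ _ 4 fun x _ ↦ ?_).trans_eq ?_) _
  · have := h.degree_le x
    lia
  · rw [card_erase_of_mem hw, card_neighborFinset_eq_degree, smul_eq_mul, mul_comm]

theorem degree_ne_one (h : G.IsInjCritical) (v : V) : G.degree v ≠ 1 := by
  intro hv
  obtain ⟨w, hw⟩ := (G.degree_pos_iff_exists_adj v).mp (show 0 < G.degree v by lia)
  have h1 := h.injDegree_le hw
  have h2 := h.degree_le w
  exact h.not_colorable (exists_isInjColoring_of_degree_eq_one h.of_lt hv
    ((card_injNeighborFinset_le v).trans_lt (show G.injDegree v < 7 by lia)))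

theorem two_le_degree (h : G.IsInjCritical) {v w : V} (hvw : G.Adj v w) : 2 ≤ G.degree w := by
  have h1 := h.degree_ne_one w
  have h2 := (G.degree_pos_iff_exists_adj w).mpr ⟨v, hvw.symm⟩
  lia

theorem three_le_degree (h : G.IsInjCritical) {v w : V} (hv : G.degree v = 2) (hvw : G.Adj v w) :
    3 ≤ G.degree w := by
  have h1 := h.two_le_degree hvw
  have h2 := h.injDegree_le hvw
  have h3 := h.injDegree_le hvw.symm
  have h4 := h.seven_le_or hvw
  by_contra! h5
  have h6 : G.degree w = 2 := by lia
  rw [h6, hv] at h2 h3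
  lia

theorem seven_le_injDegree (h : G.IsInjCritical) {v x : V} (hv : G.degree v = 3) (hvx : G.Adj v x)
    (hx : G.degree x = 2) : 7 ≤ G.injDegree v := by
  refine (h.seven_le_or hvx).resolve_right fun h1 ↦ ?_
  have h2 := h.injDegree_le hvx.symm
  rw [hv, hx] at h2
  lia

theorem mem_lightFinset_of_mem_lightNbrFinset (h : G.IsInjCritical) {u v w : V}
    (hw : w ∈ G.lightNbrFinset) (hu : G.Adj w u) (hv : G.Adj w v) (huv : u ≠ v) :
    (u ∈ G.lightFinset ∧ G.degree v = 5) ∨ (v ∈ G.lightFinset ∧ G.degree u = 5) := by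
  obtain ⟨hw2, x, hx, hwx⟩ := mem_lightNbrFinset.mp hw
  have hx' := mem_lightFinset.mp hx
  have h7 := (h.seven_le_or hwx).resolve_right (by lia)
  have hN := neighborFinset_eq_pair hw2 hu hv huv
  rw [injDegree, hN, sum_pair huv] at h7
  have hxN : x ∈ G.neighborFinset w := by simpa using hwx
  have hu5 := h.degree_le u
  have hv5 := h.degree_le v
  rw [hN, mem_insert, mem_singleton] at hxN
  rcases hxN with rfl | rfl
  · exact Or.inl ⟨hx, by lia⟩
  · exact Or.inr ⟨hx, by lia⟩

theorem mem_or_degree_eq_of_mem_lightNbrFinset (h : G.IsInjCritical) {u w : V}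
    (hw : w ∈ G.lightNbrFinset) (hu : G.Adj w u) : u ∈ G.lightFinset ∨ G.degree u = 5 := by
  obtain ⟨hw2, x, hx, hwx⟩ := mem_lightNbrFinset.mp hw
  by_cases hux : u = x
  · exact Or.inl (hux ▸ hx)
  · rcases h.mem_lightFinset_of_mem_lightNbrFinset hw hu hwx hux with h1 | h1
    · exact Or.inl h1.1
    · exact Or.inr h1.2

theorem notMem_lightNbrFinset (h : G.IsInjCritical) {u w : V}
    (hw : w ∈ G.lightNbrFinset) (hu : G.Adj w u) :
    u ∉ G.lightNbrFinset := fun hu' ↦ by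
  have h1 := h.three_le_degree (mem_lightNbrFinset.mp hw).1 hu
  rw [(mem_lightNbrFinset.mp hu').1] at h1
  lia

theorem card_lightFinset_mul_three_le (h : G.IsInjCritical) :
    #G.lightFinset * 3 ≤ #G.lightNbrFinset := by
  rw [← mul_one #G.lightNbrFinset]
  refine card_mul_le_card_mul G.Adj (fun x hx ↦ ?_) fun w hw ↦ ?_
  · obtain ⟨hx4, hx5⟩ := mem_lightFinset.mp hx
    have hsub : {w ∈ G.neighborFinset x | G.degree w = 2} ⊆
        G.lightNbrFinset.bipartiteAbove G.Adj x := by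
      intro w hw
      rw [mem_filter, mem_neighborFinset] at hw
      rw [mem_bipartiteAbove]
      exact ⟨mem_lightNbrFinset.mpr ⟨hw.2, x, hx, hw.1.symm⟩, hw.1⟩
    refine le_trans ?_ (card_le_card hsub)
    have h1 := card_filter_add_card_filter_not (s := G.neighborFinset x) (G.degree · = 2)
    rw [card_neighborFinset_eq_degree, hx4] at h1
    have h2 : ∑ w ∈ G.neighborFinset x, (1 + if ¬ G.degree w = 2 then 1 else 0) ≤
        G.injDegree x := sum_le_sum fun w hw ↦ by
      have := h.two_le_degree ((mem_neighborFinset ..).mp hw)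
      split_ifs <;> lia
    rw [sum_add_distrib, ← card_filter, ← card_eq_sum_ones, card_neighborFinset_eq_degree,
      hx4] at h2
    lia
  · refine card_le_one.mpr fun x hx y hy ↦ ?_
    rw [mem_bipartiteBelow] at hx hy
    by_contra hxy
    have hx4 := (mem_lightFinset.mp hx.1).1
    have hy4 := (mem_lightFinset.mp hy.1).1
    rcases h.mem_lightFinset_of_mem_lightNbrFinset hw hx.2.symm hy.2.symm hxy with h1 | h1 <;> lia

end IsInjCritical

variable (G) in
/-- The subgraph of the edges incident to 2-vertices with a light neighbor. -/
def lightSubgraph : SimpleGraph V where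
  Adj u v := G.Adj u v ∧ (u ∈ G.lightNbrFinset ∨ v ∈ G.lightNbrFinset)
  symm := ⟨fun _ _ h ↦ ⟨h.1.symm, h.2.symm⟩⟩
  loopless := ⟨fun _ h ↦ h.1.ne rfl⟩

instance : DecidableRel G.lightSubgraph.Adj :=
  fun u v ↦ inferInstanceAs
    (Decidable (G.Adj u v ∧ (u ∈ G.lightNbrFinset ∨ v ∈ G.lightNbrFinset)))

namespace IsInjCritical

theorem mem_iff_of_lightSubgraph_adj (h : G.IsInjCritical) {u v : V}
    (huv : G.lightSubgraph.Adj u v) :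
    u ∈ G.lightNbrFinset ↔ v ∉ G.lightNbrFinset :=
  ⟨fun hu ↦ h.notMem_lightNbrFinset hu huv.1, fun hv ↦ huv.2.resolve_right hv⟩

theorem card_edgeFinset_lightSubgraph (h : G.IsInjCritical) :
    #G.lightSubgraph.edgeFinset = 2 * #G.lightNbrFinset := by
  have hb : G.lightSubgraph.IsBipartiteWith G.lightNbrFinset ↑(G.lightNbrFinset)ᶜ := by
    refine ⟨by simp [disjoint_compl_right], fun u v huv ↦ ?_⟩
    have := h.mem_iff_of_lightSubgraph_adj huv
    simp only [mem_coe, mem_compl]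
    tauto
  rw [← isBipartiteWith_sum_degrees_eq_card_edges hb, mul_comm]
  refine sum_const_nat fun w hw ↦ ?_
  rw [← (mem_lightNbrFinset.mp hw).1, ← card_neighborFinset_eq_degree,
    ← card_neighborFinset_eq_degree]
  congr 1
  ext u
  rw [mem_neighborFinset, mem_neighborFinset]
  simp [lightSubgraph, hw]

theorem isAcyclic_lightSubgraph (h : G.IsInjCritical) : G.lightSubgraph.IsAcyclic := by
  by_contra hcyc
  obtain ⟨n, hn, g₀, hg₀, hadj₀⟩ := exists_periodic_of_not_isAcyclic hcyc
  have hne2 : ∀ i, ¬ i ≡ i + 2 [MOD n] := fun i hi ↦ by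
    have h' := (Nat.modEq_iff_dvd' (Nat.le_add_right i 2)).mp hi
    rw [Nat.add_sub_cancel_left] at h'
    exact absurd (Nat.le_of_dvd (by lia) h') (by lia)
  have halt₀ := fun i ↦ h.mem_iff_of_lightSubgraph_adj (hadj₀ i)
  obtain ⟨i₁, hi₁⟩ : ∃ i, g₀ i ∈ G.lightFinset := by
    obtain ⟨i, hi⟩ : ∃ i, g₀ (i + 1) ∈ G.lightNbrFinset := by
      by_cases h1 : g₀ 1 ∈ G.lightNbrFinset
      · exact ⟨0, h1⟩
      · exact ⟨1, by_contra fun h2 ↦ h1 ((halt₀ 1).mpr h2)⟩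
    rcases h.mem_lightFinset_of_mem_lightNbrFinset hi (hadj₀ i).1.symm (hadj₀ (i + 1)).1
      (by rw [Ne, hg₀]; exact hne2 i) with h1 | h1
    · exact ⟨i, h1.1⟩
    · exact ⟨i + 2, h1.1⟩
  obtain ⟨g, hg, hadj, h0⟩ : ∃ g : ℕ → V, (∀ i j, g i = g j ↔ i ≡ j [MOD n]) ∧
      (∀ i, G.lightSubgraph.Adj (g i) (g (i + 1))) ∧ g 0 ∈ G.lightFinset :=
    ⟨fun i ↦ g₀ (i₁ + i), fun i j ↦ (hg₀ _ _).trans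
      ⟨fun h ↦ h.add_left_cancel' i₁, fun h ↦ h.add_left i₁⟩, fun i ↦ hadj₀ (i₁ + i), hi₁⟩
  have halt := fun i ↦ h.mem_iff_of_lightSubgraph_adj (hadj i)
  have heo : ∀ j, g (2 * j) ∉ G.lightNbrFinset ∧ g (2 * j + 1) ∈ G.lightNbrFinset := by
    intro j
    induction j with
    | zero =>
      have h1 : g 0 ∉ G.lightNbrFinset := fun h1 ↦ by
        have h2 := (mem_lightFinset.mp h0).1
        rw [(mem_lightNbrFinset.mp h1).1] at h2
        lia
      exact ⟨h1, by_contra fun h2 ↦ h1 ((halt 0).mpr h2)⟩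
    | succ j ih =>
      have h1 := (halt (2 * j + 1)).mp ih.2
      exact ⟨h1, by_contra fun h2 ↦ h1 ((halt (2 * j + 2)).mpr h2)⟩
  have hstep : ∀ j, (g (2 * j) ∈ G.lightFinset ∧ G.degree (g (2 * j + 2)) = 5) ∨
      (g (2 * j + 2) ∈ G.lightFinset ∧ G.degree (g (2 * j)) = 5) := fun j ↦
    h.mem_lightFinset_of_mem_lightNbrFinset (heo j).2 (hadj _).1.symm (hadj _).1
      (by rw [Ne, hg]; exact hne2 _)
  have hdeg : ∀ x ∈ G.lightFinset, G.degree x = 4 := fun x hx ↦ (mem_lightFinset.mp hx).1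
  have h4 : ∀ q, g (4 * q) ∈ G.lightFinset ∧ G.degree (g (4 * q + 2)) = 5 := by
    have hA : ∀ q, g (4 * q) ∈ G.lightFinset → G.degree (g (4 * q + 2)) = 5 := fun q hq ↦ by
      have h1 := hstep (2 * q)
      have h2 := hdeg _ hq
      rw [show 2 * (2 * q) = 4 * q by lia] at h1
      rcases h1 with h1 | h1 <;> lia
    intro q
    induction q with
    | zero => exact ⟨h0, hA 0 h0⟩
    | succ q ih =>
      have h1 : g (4 * (q + 1)) ∈ G.lightFinset := by
        have h2 := hstep (2 * q + 1)
        rw [show 2 * (2 * q + 1) = 4 * q + 2 by lia] at h2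
        rcases h2 with h2 | h2
        · have := hdeg _ h2.1
          lia
        · exact h2.1
      exact ⟨h1, hA _ h1⟩
  have hn0 : g n = g 0 := (hg n 0).mpr (by simp [Nat.ModEq])
  have hn4 : G.degree (g n) = 4 := hn0 ▸ hdeg _ h0
  obtain ⟨m, rfl⟩ : ∃ m, n = 4 * m := by
    have hdm := Nat.div_add_mod n 4
    have hlt := Nat.mod_lt n (show 0 < 4 by lia)
    have hodd : ∀ j, n ≠ 2 * j + 1 := fun j hj ↦ by
      have h1 := (mem_lightNbrFinset.mp (heo j).2).1
      rw [← hj] at h1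
      lia
    have h2 : n ≠ 4 * (n / 4) + 2 := fun hj ↦ by
      have h1 := (h4 (n / 4)).2
      rw [← hj] at h1
      lia
    have h1 := hodd (2 * (n / 4))
    have h3 := hodd (2 * (n / 4) + 1)
    exact ⟨n / 4, by lia⟩
  refine h.not_colorable (exists_isInjColoring_of_cycle h.of_lt (by lia) hg (fun i ↦ (hadj i).1)
    (fun i ↦ (mem_lightNbrFinset.mp (heo i).2).1) (fun i ↦ ?_)
    ((card_injNeighborFinset_le _).trans_lt (show G.injDegree (g 0) < 7 from ?_)))
  · rcases hstep i with h1 | h1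
    · rw [hdeg _ h1.1, h1.2]
    · rw [hdeg _ h1.1, h1.2]
  · have := (mem_lightFinset.mp h0).2
    lia

theorem two_mul_card_lightFinset_le (h : G.IsInjCritical) :
    2 * #G.lightFinset ≤ #{v | G.degree v = 5} := by
  have h1 := h.card_lightFinset_mul_three_le
  have h2 := h.isAcyclic_lightSubgraph.card_edgeFinset_le_card_of_support_subset
    (S := G.lightNbrFinset ∪ (G.lightFinset ∪ ({v | G.degree v = 5} : Finset V))) (by
      rintro u ⟨v, huv⟩
      by_cases hu : u ∈ G.lightNbrFinset
      · simp [hu]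
      · have := h.mem_or_degree_eq_of_mem_lightNbrFinset (huv.2.resolve_left hu) huv.1.symm
        simp [this])
  rw [h.card_edgeFinset_lightSubgraph] at h2
  have h3 := card_union_le G.lightNbrFinset
    (G.lightFinset ∪ ({v | G.degree v = 5} : Finset V))
  have h4 := card_union_le G.lightFinset ({v | G.degree v = 5} : Finset V)
  lia

end IsInjCritical

end Critical

section Discharging

/-- The charge, in units of `1 / 10`, that a vertex of degree `a` sends to a neighbor of degree
`b`. -/
def charge (a b : ℕ) : ℤ :=
  if b = 2 ∧ 3 ≤ a then 4 else if b = 3 ∧ 4 ≤ a then a - 3 else 0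

theorem sum_sum_charge_sub_charge (G : SimpleGraph V) [DecidableRel G.Adj] :
    ∑ v, ∑ w ∈ G.neighborFinset v,
      (charge (G.degree v) (G.degree w) - charge (G.degree w) (G.degree v)) = 0 := by
  simp_rw [sum_sub_distrib]
  rw [sub_eq_zero, sum_comm' (t' := univ) (s' := fun v ↦ G.neighborFinset v)]
  simp [adj_comm]

variable {G : SimpleGraph V} [DecidableRel G.Adj] [DecidableEq V]

theorem IsInjCritical.add_sum_charge_le (h : G.IsInjCritical) (v : V) :
    (if G.degree v ≠ 0 then 28 else 0) + (if G.degree v = 5 then 2 else 0) +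
      ∑ w ∈ G.neighborFinset v,
        (charge (G.degree v) (G.degree w) - charge (G.degree w) (G.degree v)) ≤
      10 * (G.degree v : ℤ) + if v ∈ G.lightFinset then 4 else 0 := by
  have hle := h.degree_le v
  have hne := h.degree_ne_one v
  have hcard := G.card_neighborFinset_eq_degree v
  have h2 : ∀ w ∈ G.neighborFinset v, 2 ≤ G.degree w ∧ G.degree w ≤ 5 := fun w hw ↦
    ⟨h.two_le_degree ((mem_neighborFinset ..).mp hw), h.degree_le w⟩
  have hlight : 0 ≤ (if v ∈ G.lightFinset then 4 else 0 : ℤ) := by positivity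
  obtain hv | hv | hv | hv | hv : G.degree v = 0 ∨ G.degree v = 2 ∨ G.degree v = 3 ∨
    G.degree v = 4 ∨ G.degree v = 5 := by lia
  · rw [hv, card_eq_zero] at hcard
    simpa [hv, hcard] using hlight
  · have hsum := sum_le_card_nsmul (G.neighborFinset v)
      (fun w ↦ charge (G.degree v) (G.degree w) - charge (G.degree w) (G.degree v)) (-4)
      fun w hw ↦ by
        have h3 := h.three_le_degree hv ((mem_neighborFinset ..).mp hw)
        rw [hv]
        simp only [charge]
        split_ifs <;> lia
    rw [hcard, hv] at hsum
    simp only [hv] at hsum ⊢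
    norm_num at hsum ⊢
    lia
  · rw [hv] at hcard
    have h7 : (∃ w ∈ G.neighborFinset v, G.degree w = 2) → 7 ≤ G.injDegree v := by
      rintro ⟨w, hw, hw2⟩
      exact h.seven_le_injDegree hv ((mem_neighborFinset ..).mp hw) hw2
    obtain ⟨x, y, z, hxy, hxz, hyz, hN⟩ := card_eq_three.mp hcard
    rw [injDegree] at h7
    rw [hN] at h7 h2 ⊢
    rw [sum_insert (by simp [hxy, hxz]), sum_pair hyz] at h7 ⊢
    simp only [mem_insert, mem_singleton, forall_eq_or_imp, forall_eq, exists_eq_or_imp,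
      exists_eq_left] at h2 h7
    have hb : ∀ b, 2 ≤ b → b ≤ 5 →
        charge 3 b - charge b 3 = (if b = 2 then 4 else 3 - b : ℤ) := by
      intro b hb2 hb5
      interval_cases b <;> simp [charge]
    rw [hv, hb _ h2.1.1 h2.1.2, hb _ h2.2.1.1 h2.2.1.2, hb _ h2.2.2.1 h2.2.2.2]
    lia
  · rw [hv] at hcard
    have hS : v ∉ G.lightFinset → 6 ≤ G.injDegree v := fun hv' ↦ by
      rw [mem_lightFinset] at hv'
      lia
    obtain ⟨x, y, z, t, hxy, hxz, hxt, hyz, hyt, hzt, hN⟩ := card_eq_four.mp hcard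
    rw [injDegree] at hS
    rw [hN] at hS h2 ⊢
    rw [sum_insert (by simp [hxy, hxz, hxt]), sum_insert (by simp [hyz, hyt]),
      sum_pair hzt] at hS ⊢
    simp only [mem_insert, mem_singleton, forall_eq_or_imp, forall_eq] at h2
    have hb : ∀ b, 2 ≤ b → b ≤ 5 →
        charge 4 b - charge b 4 = (if b = 2 then 4 else if b = 3 then 1 else 0 : ℤ) := by
      intro b hb2 hb5
      interval_cases b <;> simp [charge]
    rw [hv, hb _ h2.1.1 h2.1.2, hb _ h2.2.1.1 h2.2.1.2, hb _ h2.2.2.1.1 h2.2.2.1.2,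
      hb _ h2.2.2.2.1 h2.2.2.2.2]
    lia
  · have hsum := sum_le_card_nsmul (G.neighborFinset v)
      (fun w ↦ charge (G.degree v) (G.degree w) - charge (G.degree w) (G.degree v)) 4
      fun w hw ↦ by
        have h3 := h2 w hw
        rw [hv]
        simp only [charge]
        split_ifs <;> lia
    rw [hcard, hv] at hsum
    simp only [hv] at hsum ⊢
    norm_num at hsum ⊢
    lia

theorem IsInjCritical.mul_card_support_le (h : G.IsInjCritical) :
    14 * #{v | G.degree v ≠ 0} ≤ 10 * #G.edgeFinset := by
  have hsum := sum_le_sum fun v (_ : v ∈ univ) ↦ h.add_sum_charge_le v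
  simp_rw [sum_add_distrib, sum_sum_charge_sub_charge, ← mul_sum, ← Nat.cast_sum,
    sum_degrees_eq_twice_card_edges, ← sum_filter, sum_const] at hsum
  have hB := h.two_mul_card_lightFinset_le
  simp only [nsmul_eq_mul, filter_mem_eq_inter, univ_inter] at hsum
  push_cast at hsum
  lia

end Discharging

theorem exists_isInjColoring_fin_seven (G : SimpleGraph V)
    (hdeg : ∀ v, (G.neighborSet v).ncard ≤ 5)
    (hsparse : ∀ H ≤ G, H ≠ ⊥ → 10 * H.edgeSet.ncard < 14 * H.support.ncard) :
    ∃ c : V → Fin 7, IsInjColoring G c := by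
  classical
  induction G using WellFoundedLT.induction with
  | ind G ih =>
  by_contra hG
  have hcrit : G.IsInjCritical := by
    refine ⟨fun v ↦ ?_, hG, fun H hH ↦ ih H hH (fun v ↦ ?_) fun K hK ↦ hsparse K (hK.trans hH.le)⟩
    · rw [← card_neighborSet_eq_degree, ← Set.toFinset_card, ← Set.ncard_eq_toFinset_card']
      exact hdeg v
    · exact (Set.ncard_le_ncard fun w hw ↦ hH.le hw).trans (hdeg v)
  have hne : G ≠ ⊥ := by
    rintro rfl
    exact hG ⟨fun _ ↦ 0, by simp [IsInjColoring]⟩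
  have h1 := hsparse G le_rfl hne
  have h2 := hcrit.mul_card_support_le
  have h3 : G.support = ({v | G.degree v ≠ 0} : Finset V) := by
    ext v
    simp [mem_support, ← Nat.pos_iff_ne_zero, degree_pos_iff_exists_adj]
  rw [h3, Set.ncard_coe_finset, ← coe_edgeFinset, Set.ncard_coe_finset] at h1
  lia

end SimpleGraph

/-- If `Δ(G) = 5` and `mad(G) < 14/5`, then `χᵢ(G) ≤ 7`. -/
theorem injChromNum_le_seven_of_maxDegree_eq_five {V : Type*} [Fintype V]
    (G : SimpleGraph V) [DecidableRel G.Adj]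
    (hΔ : G.maxDegree = 5)
    (hmad : ∀ H : G.Subgraph, H.verts.Nonempty →
      (2 * H.edgeSet.ncard : ℚ) / H.verts.ncard < 14 / 5) :
    injChromNum G ≤ 7 := by
  refine Nat.sInf_le (exists_isInjColoring_fin_seven G (fun v ↦ ?_) fun H hH hne ↦ ?_)
  · rw [Set.ncard_eq_toFinset_card', Set.toFinset_card, card_neighborSet_eq_degree, ← hΔ]
    exact G.degree_le_maxDegree v
  · let H' : G.Subgraph :=
      { verts := H.support
        Adj := H.Adj
        adj_sub := fun h ↦ hH h
        edge_vert := fun h ↦ ⟨_, h⟩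
        symm := H.symm }
    have hsupp : H.support.Nonempty := by
      obtain ⟨u, v, huv⟩ := ne_bot_iff_exists_adj.mp hne
      exact ⟨u, v, huv⟩
    have hedge : H'.edgeSet = H.edgeSet := by
      ext e
      induction e with
      | h u v => rfl
    have h1 := hmad H' hsupp
    rw [hedge, show H'.verts = H.support from rfl, div_lt_div_iff₀ _ (by norm_num)] at h1
    · have h2 : 2 * H.edgeSet.ncard * 5 < 14 * H.support.ncard := by exact_mod_cast h1
      lia
    · exact_mod_cast (Set.ncard_pos (Set.toFinite _)).mpr hsupp
end
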